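/- Let W be a weight matrix function on a finite interval [a,b] and let (P_n)_{n≥0} be a sequence of orthonormal matrix polynomials with respect to W. If x_0 is a zero of P_n (i.e., det P_n(x_0) = 0), then the multiplicity of x_0 as a root of the scalar polynomial det P_n(x) (a polynomial of degree np, since the leading coefficient of P_n is invertible) is at most p. -/

import Mathlib

open Polynomial Matrix MeasureTheory

/-- Evaluation of a `p × p` matrix polynomial at a real number `x`
(entrywise evaluation, i.e. evaluation at the scalar matrix `x • 1`). -/
noncomputable def mev {p : ℕ} (P : Polynomial (Matrix (Fin p) (Fin p) ℝ)) (x : ℝ) :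
    Matrix (Fin p) (Fin p) ℝ :=
  P.eval (x • (1 : Matrix (Fin p) (Fin p) ℝ))

/-- Entrywise integral of a matrix-valued function over `[a, b]`. -/
noncomputable def mInt {p : ℕ} (a b : ℝ) (F : ℝ → Matrix (Fin p) (Fin p) ℝ) :
    Matrix (Fin p) (Fin p) ℝ :=
  Matrix.of fun i j => ∫ x in a..b, F x i j

/-- `W` is a weight matrix function on `[a, b]`: it takes symmetric values on `[a, b]`,
is measurable and (entrywise) integrable on `[a, b]`, is positive semidefinite almost
everywhere on `[a, b]`, and has nonzero determinant almost everywhere on `[a, b]`. -/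
def IsWeight (p : ℕ) (a b : ℝ) (W : ℝ → Matrix (Fin p) (Fin p) ℝ) : Prop :=
  (∀ x ∈ Set.Icc a b, (W x).IsSymm) ∧
  (∀ i j, Measurable fun x => W x i j) ∧
  (∀ i j, IntervalIntegrable (fun x => W x i j) volume a b) ∧
  (∀ᵐ x ∂volume.restrict (Set.Icc a b), (W x).PosSemidef) ∧
  (∀ᵐ x ∂volume.restrict (Set.Icc a b), (W x).det ≠ 0)

/-- `P` is a sequence of orthonormal matrix polynomials with respect to the weight
matrix `W` on `[a, b]`: `deg Pₙ = n`, the leading coefficients are invertible,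
`P₀ = I` and `∫_a^b Pₙ(x) W(x) Pₘ(x)ᵀ dx = δₙₘ I`. -/
def IsOrthonormal (p : ℕ) (a b : ℝ) (W : ℝ → Matrix (Fin p) (Fin p) ℝ)
    (P : ℕ → Polynomial (Matrix (Fin p) (Fin p) ℝ)) : Prop :=
  (∀ n, (P n).natDegree = n) ∧ (∀ n, IsUnit (P n).leadingCoeff) ∧ P 0 = 1 ∧
  ∀ n m : ℕ,
    mInt a b (fun x => mev (P n) x * W x * (mev (P m) x)ᵀ) =
      if n = m then 1 else 0

section MatrixInner

variable {p : ℕ} {a b : ℝ} {W : ℝ → Matrix (Fin p) (Fin p) ℝ}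
  {P : ℕ → Polynomial (Matrix (Fin p) (Fin p) ℝ)}

lemma mev_add (Q R : Polynomial (Matrix (Fin p) (Fin p) ℝ)) (x : ℝ) :
    mev (Q + R) x = mev Q x + mev R x :=
  eval_add

lemma mev_C_mul (A : Matrix (Fin p) (Fin p) ℝ) (Q : Polynomial (Matrix (Fin p) (Fin p) ℝ))
    (x : ℝ) : mev (C A * Q) x = A * mev Q x :=
  eval_C_mul

lemma mev_X_sub_C_mul (x₀ : ℝ) (Q : Polynomial (Matrix (Fin p) (Fin p) ℝ)) (x : ℝ) :
    mev ((X - C (algebraMap ℝ _ x₀)) * Q) x = (x - x₀) • mev Q x := by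
  simp [mev, sub_mul, X_mul, eval_C_mul, Algebra.algebraMap_eq_smul_one, sub_smul]

lemma continuous_mev_apply (Q : Polynomial (Matrix (Fin p) (Fin p) ℝ)) (i j : Fin p) :
    Continuous fun x => mev Q x i j := by
  have h (x : ℝ) : mev Q x i j = (matPolyEquiv.symm Q i j).eval x := by
    rw [← matPolyEquiv_eval, AlgEquiv.apply_symm_apply, mev, ← Algebra.algebraMap_eq_smul_one]
    rfl
  simp_rw [h]
  exact Polynomial.continuous _

lemma intervalIntegrable_mev_mul_mul
    (hW : ∀ i j, IntervalIntegrable (fun x => W x i j) volume a b)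
    (Q R : Polynomial (Matrix (Fin p) (Fin p) ℝ)) (i j : Fin p) :
    IntervalIntegrable (fun x => (mev Q x * W x * (mev R x)ᵀ) i j) volume a b := by
  simp only [Matrix.mul_apply, Matrix.transpose_apply, Finset.sum_mul]
  have := IntervalIntegrable.sum (μ := volume) (a := a) (b := b) Finset.univ
    (f := fun k x => ∑ l, mev Q x i l * W x l k * mev R x j k) fun k _ => by
      have := IntervalIntegrable.sum (μ := volume) (a := a) (b := b) Finset.univ
        (f := fun l x => mev Q x i l * W x l k * mev R x j k) fun l _ =>
          ((hW l k).continuousOn_mul (continuous_mev_apply Q i l).continuousOn).mul_continuousOn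
            (continuous_mev_apply R j k).continuousOn
      simpa only [Finset.sum_fn] using this
  simpa only [Finset.sum_fn] using this

/-- The matrix-valued inner product `∫ Q W Rᵀ` of two matrix polynomials. -/
noncomputable def matrixInner (a b : ℝ) (W : ℝ → Matrix (Fin p) (Fin p) ℝ)
    (Q R : Polynomial (Matrix (Fin p) (Fin p) ℝ)) : Matrix (Fin p) (Fin p) ℝ :=
  mInt a b fun x => mev Q x * W x * (mev R x)ᵀ

lemma matrixInner_add_left (hW : ∀ i j, IntervalIntegrable (fun x => W x i j) volume a b)
    (Q Q' R : Polynomial (Matrix (Fin p) (Fin p) ℝ)) :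
    matrixInner a b W (Q + Q') R = matrixInner a b W Q R + matrixInner a b W Q' R := by
  ext i j
  simp only [matrixInner, mInt, Matrix.of_apply, Matrix.add_apply, mev_add, Matrix.add_mul]
  exact intervalIntegral.integral_add (intervalIntegrable_mev_mul_mul hW Q R i j)
    (intervalIntegrable_mev_mul_mul hW Q' R i j)

lemma matrixInner_add_right (hW : ∀ i j, IntervalIntegrable (fun x => W x i j) volume a b)
    (Q R R' : Polynomial (Matrix (Fin p) (Fin p) ℝ)) :
    matrixInner a b W Q (R + R') = matrixInner a b W Q R + matrixInner a b W Q R' := by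
  ext i j
  simp only [matrixInner, mInt, Matrix.of_apply, Matrix.add_apply, mev_add, Matrix.transpose_add,
    Matrix.mul_add]
  exact intervalIntegral.integral_add (intervalIntegrable_mev_mul_mul hW Q R i j)
    (intervalIntegrable_mev_mul_mul hW Q R' i j)

lemma matrixInner_C_mul_left (hW : ∀ i j, IntervalIntegrable (fun x => W x i j) volume a b)
    (A : Matrix (Fin p) (Fin p) ℝ) (Q R : Polynomial (Matrix (Fin p) (Fin p) ℝ)) :
    matrixInner a b W (C A * Q) R = A * matrixInner a b W Q R := by
  ext i j
  simp only [matrixInner, mInt, Matrix.of_apply, mev_C_mul, Matrix.mul_assoc A]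
  simp only [Matrix.mul_apply (M := A), Matrix.of_apply]
  rw [intervalIntegral.integral_finsetSum fun k _ =>
    (intervalIntegrable_mev_mul_mul hW Q R k j).const_mul _]
  simp only [intervalIntegral.integral_const_mul]

lemma matrixInner_C_mul_right (hW : ∀ i j, IntervalIntegrable (fun x => W x i j) volume a b)
    (A : Matrix (Fin p) (Fin p) ℝ) (Q R : Polynomial (Matrix (Fin p) (Fin p) ℝ)) :
    matrixInner a b W Q (C A * R) = matrixInner a b W Q R * Aᵀ := by
  ext i j
  simp only [matrixInner, mInt, Matrix.of_apply, mev_C_mul, Matrix.transpose_mul,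
    ← Matrix.mul_assoc]
  simp only [Matrix.mul_apply (N := Aᵀ), Matrix.of_apply]
  rw [intervalIntegral.integral_finsetSum fun k _ =>
    (intervalIntegrable_mev_mul_mul hW Q R i k).mul_const _]
  simp only [intervalIntegral.integral_mul_const]

lemma matrixInner_X_sub_C_mul (x₀ : ℝ) (Q R : Polynomial (Matrix (Fin p) (Fin p) ℝ)) :
    matrixInner a b W ((X - C (algebraMap ℝ _ x₀)) * Q) R =
      matrixInner a b W Q ((X - C (algebraMap ℝ _ x₀)) * R) := by
  simp only [matrixInner, mev_X_sub_C_mul, Matrix.transpose_smul, Matrix.smul_mul,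
    Matrix.mul_smul]

lemma matrixInner_zero_left (R : Polynomial (Matrix (Fin p) (Fin p) ℝ)) :
    matrixInner a b W 0 R = 0 := by
  ext i j
  simp [matrixInner, mInt, mev]

lemma matrixInner_zero_right (Q : Polynomial (Matrix (Fin p) (Fin p) ℝ)) :
    matrixInner a b W Q 0 = 0 := by
  ext i j
  simp [matrixInner, mInt, mev]

namespace IsOrthonormal

lemma exists_eq_C_mul_add (hP : IsOrthonormal p a b W P) {n : ℕ}
    {Q : Polynomial (Matrix (Fin p) (Fin p) ℝ)} (hQ : Q.degree < (n + 1 : ℕ)) :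
    ∃ A, ∃ Q' : Polynomial (Matrix (Fin p) (Fin p) ℝ), Q = C A * P n + Q' ∧ Q'.degree < n := by
  obtain ⟨u, hu⟩ := hP.2.1 n
  have hcoeff : (P n).coeff n = u := by rw [hu, leadingCoeff, hP.1 n]
  refine ⟨Q.coeff n * (u⁻¹).val, Q - C (Q.coeff n * (u⁻¹).val) * P n, (add_sub_cancel _ _).symm, ?_⟩
  rw [degree_lt_iff_coeff_zero] at hQ ⊢
  intro m hm
  rcases hm.eq_or_lt with rfl | hm
  · simp [coeff_C_mul, hcoeff, mul_assoc]
  · have : (P n).coeff m = 0 := coeff_eq_zero_of_natDegree_lt (by rwa [hP.1 n])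
    rw [coeff_sub, coeff_C_mul, hQ m hm, this, mul_zero, sub_zero]

lemma matrixInner_eq (hP : IsOrthonormal p a b W P) (n m : ℕ) :
    matrixInner a b W (P n) (P m) = if n = m then 1 else 0 :=
  hP.2.2.2 n m

lemma matrixInner_eq_zero_of_degree_lt (hP : IsOrthonormal p a b W P)
    (hW : ∀ i j, IntervalIntegrable (fun x => W x i j) volume a b) {n m : ℕ} (hnm : n ≤ m)
    {Q : Polynomial (Matrix (Fin p) (Fin p) ℝ)} (hQ : Q.degree < n) :
    matrixInner a b W Q (P m) = 0 ∧ matrixInner a b W (P m) Q = 0 := by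
  induction n generalizing Q with
  | zero =>
    obtain rfl : Q = 0 := by simpa using hQ
    exact ⟨matrixInner_zero_left _, matrixInner_zero_right _⟩
  | succ n ih =>
    obtain ⟨A, Q', rfl, hQ'⟩ := hP.exists_eq_C_mul_add hQ
    obtain ⟨h₁, h₂⟩ := ih (by omega) hQ'
    rw [matrixInner_add_left hW, matrixInner_add_right hW, matrixInner_C_mul_left hW,
      matrixInner_C_mul_right hW, h₁, h₂, hP.matrixInner_eq, hP.matrixInner_eq,
      if_neg (by omega), if_neg (by omega)]
    simp

lemma trace_matrixInner_self (hP : IsOrthonormal p a b W P)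
    (hW : ∀ i j, IntervalIntegrable (fun x => W x i j) volume a b) {n : ℕ}
    {Q : Polynomial (Matrix (Fin p) (Fin p) ℝ)} (hQ : Q.degree < n) :
    0 ≤ (matrixInner a b W Q Q).trace ∧ ((matrixInner a b W Q Q).trace = 0 → Q = 0) := by
  induction n generalizing Q with
  | zero =>
    obtain rfl : Q = 0 := by simpa using hQ
    simp [matrixInner_zero_left]
  | succ n ih =>
    obtain ⟨A, Q', rfl, hQ'⟩ := hP.exists_eq_C_mul_add hQ
    obtain ⟨h₁, h₂⟩ := hP.matrixInner_eq_zero_of_degree_lt hW le_rfl hQ'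
    have key : matrixInner a b W (C A * P n + Q') (C A * P n + Q') =
        A * Aᴴ + matrixInner a b W Q' Q' := by
      simp [matrixInner_add_left hW, matrixInner_add_right hW, matrixInner_C_mul_left hW,
        matrixInner_C_mul_right hW, h₁, h₂, hP.matrixInner_eq]
    obtain ⟨h₃, h₄⟩ := ih hQ'
    have h₅ := (Matrix.posSemidef_self_mul_conjTranspose A).trace_nonneg
    rw [key, Matrix.trace_add]
    refine ⟨add_nonneg h₅ h₃, fun h => ?_⟩
    have hA : A = 0 := Matrix.trace_mul_conjTranspose_self_eq_zero_iff.1 (by linarith)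
    rw [h₄ (by linarith), hA, C_0, zero_mul, add_zero]

/-- An orthonormal matrix polynomial has no Jordan chains of length two. -/
lemma X_sub_C_dvd_of_sq_dvd_mul [NeZero p] (hP : IsOrthonormal p a b W P)
    (hW : ∀ i j, IntervalIntegrable (fun x => W x i j) volume a b) (n : ℕ) (x₀ : ℝ)
    {U : Polynomial (Matrix (Fin p) (Fin p) ℝ)}
    (hU : (X - C (algebraMap ℝ _ x₀)) ^ 2 ∣ U * P n) :
    X - C (algebraMap ℝ _ x₀) ∣ U := by
  set q : Polynomial (Matrix (Fin p) (Fin p) ℝ) := X - C (algebraMap ℝ _ x₀) with hq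
  have hqm : q.Monic := monic_X_sub_C _
  have hqd : q.degree = 1 := degree_X_sub_C _
  have hcomm (R : Polynomial (Matrix (Fin p) (Fin p) ℝ)) : q * R = R * q := by
    have : C (algebraMap ℝ (Matrix (Fin p) (Fin p) ℝ) x₀) * R = R * C (algebraMap ℝ _ x₀) := by
      ext k : 1
      simp only [coeff_C_mul, coeff_mul_C, Algebra.commutes]
    rw [hq, sub_mul, mul_sub, X_mul, this]
  have hmod (R : Polynomial (Matrix (Fin p) (Fin p) ℝ)) : ∃ A S, R = C A + q * S := by
    have h := degree_modByMonic_lt R hqm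
    rw [hqd] at h
    obtain ⟨A, hA⟩ : ∃ A, R %ₘ q = C A := ⟨_, eq_C_of_degree_le_zero (Nat.WithBot.lt_one_iff_le_zero.1 h)⟩
    exact ⟨A, R /ₘ q, by rw [← hA, modByMonic_add_div]⟩
  obtain ⟨A₀, U₁, rfl⟩ := hmod U
  obtain ⟨A₁, U₂, rfl⟩ := hmod U₁
  obtain ⟨T, hT⟩ := hU
  have hdeg : (P n).degree ≤ n := by simpa [hP.1 n] using (P n).degree_le_natDegree
  have hCdeg (A : Matrix (Fin p) (Fin p) ℝ) : (C A * P n).degree ≤ n :=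
    (degree_mul_le _ _).trans (by simpa using add_le_add (degree_C_le (a := A)) hdeg)
  obtain ⟨R, hR⟩ : ∃ R, C A₀ * P n + q * (C A₁ * P n) = q ^ 2 * R :=
    ⟨T - U₂ * P n, by rw [mul_sub, ← hT]; noncomm_ring⟩
  have hlt {S : Polynomial (Matrix (Fin p) (Fin p) ℝ)} {k : ℕ} (h : (S * q).degree ≤ k) :
      S.degree < k := by
    rcases eq_or_ne S 0 with rfl | hS
    · simp
    rw [hqm.degree_mul, hqd, degree_eq_natDegree hS] at h
    rw [degree_eq_natDegree hS]
    exact_mod_cast h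
  have hS : q * (q * R - C A₁ * P n) = C A₀ * P n := by
    rw [mul_sub, ← mul_assoc, ← sq, ← hR]; abel
  have hSdeg : (q * R - C A₁ * P n).degree < n := hlt (by rw [← hcomm, hS]; exact hCdeg A₀)
  have hRdeg : R.degree < n := by
    have h : (q * R * q).degree ≤ (n + 1 : ℕ) := by
      rw [← hcomm, ← mul_assoc, ← sq, ← hR, hcomm]
      refine (degree_add_le _ _).trans (max_le ((hCdeg A₀).trans ?_) ?_)
      · exact_mod_cast n.le_succ
      · rw [hqm.degree_mul, hqd]
        exact_mod_cast add_le_add_left (hCdeg A₁) 1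
    refine hlt ?_
    rw [← hcomm]
    exact Order.le_of_lt_succ (by exact_mod_cast hlt h)
  set S := q * R - C A₁ * P n with hSdef
  have hS0 : S = 0 := by
    refine (hP.trace_matrixInner_self hW hSdeg).2 ?_
    have h₁ : matrixInner a b W S (q * R) = 0 := by
      rw [← matrixInner_X_sub_C_mul, hS, matrixInner_C_mul_left hW,
        (hP.matrixInner_eq_zero_of_degree_lt hW le_rfl hRdeg).2, mul_zero]
    have h₂ : S = q * R + C (-A₁) * P n := by
      refine sub_eq_of_eq_add ?_
      rw [add_assoc, ← add_mul, ← C_add, neg_add_cancel, C_0, zero_mul, add_zero]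
    have h₃ : matrixInner a b W S S = 0 := by
      have h := congrArg (matrixInner a b W S) h₂
      rw [matrixInner_add_right hW, matrixInner_C_mul_right hW, h₁,
        (hP.matrixInner_eq_zero_of_degree_lt hW le_rfl hSdeg).1] at h
      simpa using h
    rw [h₃, Matrix.trace_zero]
  have hA₀ : A₀ = 0 := by
    rw [hS0, mul_zero] at hS
    have h := congrArg (coeff · n) hS
    obtain ⟨u, hu⟩ := hP.2.1 n
    have hcoeff : (P n).coeff n = u := by rw [hu, leadingCoeff, hP.1 n]
    simpa [coeff_C_mul, hcoeff] using h.symm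
  exact ⟨C A₁ + q * U₂, by simp [hA₀]⟩

end IsOrthonormal

end MatrixInner

/-- The zeros of the orthonormal matrix polynomial `Pₙ` have multiplicity at most `p`:
if `det Pₙ(x₀) = 0`, then the multiplicity of `x₀` as a root of the scalar polynomial
`det Pₙ(x)` is at most `p`. -/
theorem zero_multiplicity_le {p : ℕ} (a b : ℝ)
    (W : ℝ → Matrix (Fin p) (Fin p) ℝ) (hW : IsWeight p a b W)
    (P : ℕ → Polynomial (Matrix (Fin p) (Fin p) ℝ))
    (hP : IsOrthonormal p a b W P)
    (n : ℕ) (x₀ : ℝ) (hx₀ : (mev (P n) x₀).det = 0) :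
    ((matPolyEquiv.symm (P n)).det).rootMultiplicity x₀ ≤ p := by
  have hp : NeZero p := ⟨by rintro rfl; simp at hx₀⟩
  have hp0 : p ≠ 0 := hp.ne
  set M := matPolyEquiv.symm (P n) with hM
  have hMP : matPolyEquiv M = P n := AlgEquiv.apply_symm_apply _ _
  set m := M.det.rootMultiplicity x₀ with hm
  by_cases hdet : M.det = 0
  · simp [hm, hdet]
  obtain ⟨g, hg, -⟩ := exists_eq_pow_rootMultiplicity_mul_and_not_dvd M.det hdet x₀
  have hadj : matPolyEquiv M.adjugate ≠ 0 := by
    intro h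
    have h0 : M.adjugate = 0 := by simpa using h
    have h1 := Matrix.mul_adjugate M
    rw [h0, mul_zero] at h1
    have := congrFun (congrFun h1 0) 0
    exact hdet (by simpa using this.symm)
  obtain ⟨A, hA, hAq⟩ := exists_eq_pow_rootMultiplicity_mul_and_not_dvd
    (matPolyEquiv M.adjugate) hadj (algebraMap ℝ _ x₀)
  set j := rootMultiplicity _ (matPolyEquiv M.adjugate)
  have hmap (k : ℕ) : ((X - C x₀) ^ k).map (algebraMap ℝ (Matrix (Fin p) (Fin p) ℝ)) =
      (X - C (algebraMap ℝ _ x₀)) ^ k := by simp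
  have hmj : m ≤ j + 1 := by
    by_contra! hlt
    refine hAq (hP.X_sub_C_dvd_of_sq_dvd_mul hW.2.2.1 n x₀ ?_)
    obtain ⟨k, hk⟩ : ∃ k, m = j + (2 + k) := ⟨m - j - 2, by omega⟩
    have h : matPolyEquiv (M.adjugate * M) = matPolyEquiv (M.det • 1) := by
      rw [Matrix.adjugate_mul]
    rw [map_mul, hMP, hA, matPolyEquiv_smul_one, hg, Polynomial.map_mul, hmap, ← hm, hk, pow_add,
      mul_assoc, mul_assoc] at h
    have h := ((monic_X_sub_C _).pow j).isRegular.left h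
    rw [h, pow_add, mul_assoc]
    exact dvd_mul_right _ _
  have hjp : j * p ≤ m * (p - 1) := by
    have h1 : M.adjugate = (X - C x₀) ^ j • matPolyEquiv.symm A := by
      apply matPolyEquiv.injective
      rw [matPolyEquiv_map_smul, hmap, AlgEquiv.apply_symm_apply, ← hA]
    have h2 := Matrix.det_adjugate M
    rw [h1, Matrix.det_smul, Fintype.card_fin, ← pow_mul] at h2
    have h3 : (X - C x₀) ^ (j * p) ∣ M.det ^ (p - 1) := Dvd.intro _ h2
    rw [← le_rootMultiplicity_iff (pow_ne_zero _ hdet)] at h3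
    refine h3.trans_eq ?_
    rw [← count_roots, roots_pow, Multiset.count_nsmul, count_roots, mul_comm]
  obtain ⟨r, rfl⟩ := Nat.exists_eq_succ_of_ne_zero hp0
  simp only [Nat.succ_eq_add_one, Nat.add_sub_cancel] at hjp ⊢
  nlinarith
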